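/- Let K be a field, let q ∈ K have multiplicative order e (possibly infinite), and let f be an integer with 0 ≤ f and 2f ≤ e. If 1 ≤ m ≤ n and the Iwahori–Hecke algebra H_q(B_m) has infinite representation type, then H_q(B_n) has infinite representation type. -/

import Mathlib

/-- A finite-dimensional right `A`-module, where `A` is a `K`-algebra.
Right modules are modules over the opposite ring `Aᵐᵒᵖ`. -/
structure FDRightModule (K A : Type) [Field K] [Ring A] [Algebra K A] : Type 1 where
  carrier : Type
  [isAddCommGroup : AddCommGroup carrier]
  [isModuleK : Module K carrier]
  [isModuleA : Module Aᵐᵒᵖ carrier]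
  [isTower : IsScalarTower K Aᵐᵒᵖ carrier]
  [isFinDim : FiniteDimensional K carrier]

attribute [instance] FDRightModule.isAddCommGroup FDRightModule.isModuleK
  FDRightModule.isModuleA FDRightModule.isTower FDRightModule.isFinDim

/-- A module is indecomposable if it is nonzero and is not the (internal) direct
sum of two nonzero submodules. -/
def IsIndecomposableModule (R M : Type*) [Ring R] [AddCommGroup M] [Module R M] : Prop :=
  Nontrivial M ∧ ∀ N₁ N₂ : Submodule R M, IsCompl N₁ N₂ → N₁ = ⊥ ∨ N₂ = ⊥

/-- A `K`-algebra `A` has finite representation type if there are only finitely many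
isomorphism classes of indecomposable finite-dimensional right `A`-modules. -/
def HasFiniteRepresentationType (K A : Type) [Field K] [Ring A] [Algebra K A] : Prop :=
  Finite (Quot fun M N : {M : FDRightModule K A // IsIndecomposableModule Aᵐᵒᵖ M.carrier} =>
    Nonempty (M.1.carrier ≃ₗ[Aᵐᵒᵖ] N.1.carrier))
/-- The multiplicative order of an element, valued in `ℕ∞`, with `⊤` for infinite order. -/
noncomputable def multOrder {M : Type*} [Monoid M] (x : M) : ℕ∞ :=
  if orderOf x = 0 then ⊤ else (orderOf x : ℕ∞)
/-- The defining relations of the Iwahori--Hecke algebra of type `Bₙ` with generators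
`T_0, …, T_{n-1}`, where `T_0` satisfies `(T_0 - α)(T_0 - β) = 0` and the other
generators satisfy `(T_i + 1)(T_i - q) = 0`. -/
inductive HeckeBRel (K : Type) [Field K] (α β q : K) (n : ℕ) :
    FreeAlgebra K (Fin n) → FreeAlgebra K (Fin n) → Prop
  | quad_zero (i : Fin n) (hi : (i : ℕ) = 0) :
      HeckeBRel K α β q n
        ((FreeAlgebra.ι K i - algebraMap K (FreeAlgebra K (Fin n)) α) *
          (FreeAlgebra.ι K i - algebraMap K (FreeAlgebra K (Fin n)) β)) 0
  | quad (i : Fin n) (hi : 0 < (i : ℕ)) :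
      HeckeBRel K α β q n
        ((FreeAlgebra.ι K i + 1) * (FreeAlgebra.ι K i - algebraMap K (FreeAlgebra K (Fin n)) q)) 0
  | braid_zero (i j : Fin n) (hi : (i : ℕ) = 0) (hj : (j : ℕ) = 1) :
      HeckeBRel K α β q n
        (FreeAlgebra.ι K i * FreeAlgebra.ι K j * FreeAlgebra.ι K i * FreeAlgebra.ι K j)
        (FreeAlgebra.ι K j * FreeAlgebra.ι K i * FreeAlgebra.ι K j * FreeAlgebra.ι K i)
  | braid (i j : Fin n) (hi : 0 < (i : ℕ)) (hij : (j : ℕ) = (i : ℕ) + 1) :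
      HeckeBRel K α β q n
        (FreeAlgebra.ι K j * FreeAlgebra.ι K i * FreeAlgebra.ι K j)
        (FreeAlgebra.ι K i * FreeAlgebra.ι K j * FreeAlgebra.ι K i)
  | comm (i j : Fin n) (hij : (i : ℕ) + 1 < (j : ℕ)) :
      HeckeBRel K α β q n (FreeAlgebra.ι K i * FreeAlgebra.ι K j)
        (FreeAlgebra.ι K j * FreeAlgebra.ι K i)

/-- The Iwahori--Hecke algebra of type `Bₙ`: the quotient of the free algebra on
`T_0, …, T_{n-1}` by the two-sided ideal generated by the defining relations, where
`T_0` satisfies `(T_0 - α)(T_0 - β) = 0`. -/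
abbrev HeckeB (K : Type) [Field K] (α β q : K) (n : ℕ) : Type := RingQuot (HeckeBRel K α β q n)

section Retract

/-- `M` is a retract (direct summand) of `N`. -/
def IsModuleRetract (R M N : Type*) [Ring R] [AddCommGroup M] [Module R M] [AddCommGroup N]
    [Module R N] : Prop :=
  ∃ (i : M →ₗ[R] N) (p : N →ₗ[R] M), p ∘ₗ i = LinearMap.id

variable {R M N N₁ N₂ : Type*} [Ring R] [AddCommGroup M] [Module R M] [AddCommGroup N]
  [Module R N] [AddCommGroup N₁] [Module R N₁] [AddCommGroup N₂] [Module R N₂]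

/-- Every endomorphism of an indecomposable module of finite length is invertible or nilpotent. -/
theorem IsIndecomposableModule.isUnit_or_isNilpotent [IsArtinian R M] [IsNoetherian R M]
    (hM : IsIndecomposableModule R M) (φ : Module.End R M) : IsUnit φ ∨ IsNilpotent φ := by
  obtain ⟨k, hk⟩ := Filter.eventually_atTop.mp φ.eventually_isCompl_ker_pow_range_pow
  rcases hM.2 _ _ (hk (k + 1) (by omega)) with h | h
  · left
    have hφ : IsUnit (φ ^ (k + 1)) :=
      (Module.End.isUnit_iff _).mpr
        (IsArtinian.bijective_of_injective_endomorphism _ (LinearMap.ker_eq_bot.mp h))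
    exact (isUnit_pow_iff (by omega)).mp hφ
  · exact Or.inr ⟨k + 1, LinearMap.range_eq_bot.mp h⟩

/-- If `p ∘ i` is invertible, then the source of `i` is a retract of its target. -/
theorem IsModuleRetract.of_isUnit_comp (i : M →ₗ[R] N) (p : N →ₗ[R] M)
    (h : IsUnit (p ∘ₗ i : Module.End R M)) : IsModuleRetract R M N := by
  obtain ⟨u, hu⟩ := h
  exact ⟨i, (↑u⁻¹ : Module.End R M) ∘ₗ p, by
    rw [LinearMap.comp_assoc, ← hu]; exact u.inv_mul⟩

/-- An indecomposable retract of a direct sum is a retract of one of the summands. -/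
theorem IsModuleRetract.of_sum [IsArtinian R M] [IsNoetherian R M]
    (hM : IsIndecomposableModule R M) (h : IsModuleRetract R M N)
    (i₁ : N₁ →ₗ[R] N) (p₁ : N →ₗ[R] N₁) (i₂ : N₂ →ₗ[R] N) (p₂ : N →ₗ[R] N₂)
    (hsum : i₁ ∘ₗ p₁ + i₂ ∘ₗ p₂ = LinearMap.id) :
    IsModuleRetract R M N₁ ∨ IsModuleRetract R M N₂ := by
  obtain ⟨i, p, hip⟩ := h
  let φ₁ : Module.End R M := (p ∘ₗ i₁) ∘ₗ (p₁ ∘ₗ i)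
  let φ₂ : Module.End R M := (p ∘ₗ i₂) ∘ₗ (p₂ ∘ₗ i)
  have hφ : φ₂ = 1 - φ₁ := by
    rw [eq_sub_iff_add_eq']
    ext m
    have := LinearMap.congr_fun hsum (i m)
    have h' := LinearMap.congr_fun hip m
    simp only [LinearMap.add_apply, LinearMap.comp_apply, LinearMap.id_apply] at this h'
    simp [φ₁, φ₂, ← map_add, this, h']
  rcases hM.isUnit_or_isNilpotent φ₁ with h₁ | h₁
  · exact Or.inl (.of_isUnit_comp _ _ h₁)
  · exact Or.inr (.of_isUnit_comp _ _ (hφ ▸ h₁.isUnit_one_sub))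

/-- A nonzero retract of an indecomposable module is isomorphic to it. -/
theorem IsModuleRetract.nonempty_linearEquiv [Nontrivial M] (hN : IsIndecomposableModule R N)
    (h : IsModuleRetract R M N) : Nonempty (M ≃ₗ[R] N) := by
  obtain ⟨i, p, hip⟩ := h
  have hi : Function.Injective i := fun x y hxy => by
    simpa using (LinearMap.congr_fun hip x).symm.trans
      ((congrArg p hxy).trans (LinearMap.congr_fun hip y))
  have hc := LinearMap.isCompl_of_proj (p := LinearMap.range i)
    (f := (LinearMap.rangeRestrict i) ∘ₗ p) (by
      rintro ⟨_, x, rfl⟩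
      have := LinearMap.congr_fun hip x
      ext; simpa using congrArg i this)
  rcases hN.2 _ _ hc with h | h
  · obtain ⟨x, hx⟩ := exists_ne (0 : M)
    exact absurd (hi ((LinearMap.congr_fun (LinearMap.range_eq_bot.mp h) x).trans
      (map_zero i).symm)) hx
  · have htop : LinearMap.range i = ⊤ := by rw [← hc.sup_eq_top, h, sup_bot_eq]
    exact ⟨LinearEquiv.ofBijective i ⟨hi, LinearMap.range_eq_top.mp htop⟩⟩

theorem IsModuleRetract.trans {L : Type*} [AddCommGroup L] [Module R L]
    (h : IsModuleRetract R M N) (h' : IsModuleRetract R N L) : IsModuleRetract R M L := by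
  obtain ⟨i, p, hip⟩ := h
  obtain ⟨j, r, hjr⟩ := h'
  refine ⟨j ∘ₗ i, p ∘ₗ r, ?_⟩
  rw [LinearMap.comp_assoc, ← LinearMap.comp_assoc i, hjr, LinearMap.id_comp, hip]

end Retract

namespace FDRightModule

variable {K A B : Type} [Field K] [Ring A] [Algebra K A] [Ring B] [Algebra K B]

instance (X : FDRightModule K A) : IsNoetherian Aᵐᵒᵖ X.carrier :=
  isNoetherian_of_tower K inferInstance

instance (X : FDRightModule K A) : IsArtinian Aᵐᵒᵖ X.carrier :=
  isArtinian_of_tower K inferInstance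

/-- A submodule of a finite-dimensional right module, as a finite-dimensional right module. -/
def ofSubmodule (X : FDRightModule K A) (N : Submodule Aᵐᵒᵖ X.carrier) :
    FDRightModule K A where
  carrier := N
  isAddCommGroup := inferInstance
  isModuleK := Submodule.module' N
  isModuleA := N.module
  isTower := inferInstance
  isFinDim := FiniteDimensional.finiteDimensional_submodule (N.restrictScalars K)

/-- Restriction of scalars along an algebra homomorphism. -/
def restrict (φ : B →ₐ[K] A) (X : FDRightModule K A) : FDRightModule K B where
  carrier := X.carrier
  isModuleA := Module.compHom X.carrier (AlgHom.op φ).toRingHom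
  isTower := by
    let _ : Module Bᵐᵒᵖ X.carrier := Module.compHom X.carrier (AlgHom.op φ).toRingHom
    refine ⟨fun c b x => ?_⟩
    change (AlgHom.op φ (c • b)) • x = c • (AlgHom.op φ b • x)
    rw [map_smul, smul_assoc]

/-- A linear map of right modules, viewed as a linear map between their restrictions. -/
def restrictMap (φ : B →ₐ[K] A) {X Y : FDRightModule K A}
    (g : X.carrier →ₗ[Aᵐᵒᵖ] Y.carrier) :
    (X.restrict φ).carrier →ₗ[Bᵐᵒᵖ] (Y.restrict φ).carrier where
  toFun := g
  map_add' := map_add g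
  map_smul' b x := LinearMap.map_smul g (AlgHom.op φ b) x

/-- A nonzero decomposable module is a direct sum of two modules of smaller dimension. -/
theorem exists_sum_of_not_indecomposable (X : FDRightModule K A) [Nontrivial X.carrier]
    (hX : ¬ IsIndecomposableModule Aᵐᵒᵖ X.carrier) :
    ∃ (X₁ X₂ : FDRightModule K A)
      (i₁ : X₁.carrier →ₗ[Aᵐᵒᵖ] X.carrier) (p₁ : X.carrier →ₗ[Aᵐᵒᵖ] X₁.carrier)
      (i₂ : X₂.carrier →ₗ[Aᵐᵒᵖ] X.carrier) (p₂ : X.carrier →ₗ[Aᵐᵒᵖ] X₂.carrier),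
      i₁ ∘ₗ p₁ + i₂ ∘ₗ p₂ = LinearMap.id ∧
      Module.finrank K X₁.carrier < Module.finrank K X.carrier ∧
      Module.finrank K X₂.carrier < Module.finrank K X.carrier := by
  simp only [IsIndecomposableModule, not_and, not_forall, not_or] at hX
  obtain ⟨N₁, N₂, hc, h₁, h₂⟩ := hX inferInstance
  refine ⟨X.ofSubmodule N₁, X.ofSubmodule N₂, N₁.subtype, N₁.projectionOnto N₂ hc,
    N₂.subtype, N₂.projectionOnto N₁ hc.symm, ?_, ?_, ?_⟩
  · refine LinearMap.ext fun x => ?_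
    exact Submodule.projection_add_projection_eq_self hc x
  · refine Submodule.finrank_lt (s := N₁.restrictScalars K) fun h => h₂ ?_
    have : N₁ = ⊤ := by simpa using h
    simpa [this] using hc.inf_eq_bot
  · refine Submodule.finrank_lt (s := N₂.restrictScalars K) fun h => h₁ ?_
    have : N₂ = ⊤ := by simpa using h
    simpa [this] using hc.inf_eq_bot

/-- An indecomposable retract of a restricted module is a retract of the restriction of
an indecomposable module. -/
theorem exists_indecomposable_of_isModuleRetract (φ : B →ₐ[K] A) (M : FDRightModule K B)
    (hM : IsIndecomposableModule Bᵐᵒᵖ M.carrier) (X : FDRightModule K A)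
    (h : IsModuleRetract Bᵐᵒᵖ M.carrier (X.restrict φ).carrier) :
    ∃ Y : FDRightModule K A, IsIndecomposableModule Aᵐᵒᵖ Y.carrier ∧
      IsModuleRetract Bᵐᵒᵖ M.carrier (Y.restrict φ).carrier := by
  induction hd : Module.finrank K X.carrier using Nat.strong_induction_on generalizing X with
  | _ d ih =>
  subst hd
  by_cases hX : IsIndecomposableModule Aᵐᵒᵖ X.carrier
  · exact ⟨X, hX, h⟩
  have : Nontrivial X.carrier := by
    obtain ⟨i, p, hip⟩ := h
    have hi : Function.Injective i := fun x y hxy => by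
      simpa using (LinearMap.congr_fun hip x).symm.trans
        ((congrArg p hxy).trans (LinearMap.congr_fun hip y))
    have := hM.1
    exact hi.nontrivial
  obtain ⟨X₁, X₂, i₁, p₁, i₂, p₂, hsum, h₁, h₂⟩ := X.exists_sum_of_not_indecomposable hX
  rcases h.of_sum hM (restrictMap φ i₁) (restrictMap φ p₁) (restrictMap φ i₂) (restrictMap φ p₂)
    (LinearMap.ext fun x => LinearMap.congr_fun hsum x) with h | h
  · exact ih _ h₁ X₁ h rfl
  · exact ih _ h₂ X₂ h rfl

variable (K A) in
/-- The indecomposable finite-dimensional right modules. -/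
abbrev Indecomposable : Type 1 :=
  {M : FDRightModule K A // IsIndecomposableModule Aᵐᵒᵖ M.carrier}

variable (K A) in
/-- The isomorphism relation on indecomposable modules. -/
abbrev Indecomposable.Iso (M N : Indecomposable K A) : Prop :=
  Nonempty (M.1.carrier ≃ₗ[Aᵐᵒᵖ] N.1.carrier)

/-- A finite-dimensional module has, up to isomorphism, only finitely many indecomposable
retracts. -/
theorem finite_indecomposable_isModuleRetract (X : FDRightModule K A) :
    {c : Quot (Indecomposable.Iso K A) | ∃ M : Indecomposable K A, Quot.mk _ M = c ∧
      IsModuleRetract Aᵐᵒᵖ M.1.carrier X.carrier}.Finite := by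
  induction hd : Module.finrank K X.carrier using Nat.strong_induction_on generalizing X with
  | _ d ih =>
  subst hd
  by_cases hX : IsIndecomposableModule Aᵐᵒᵖ X.carrier
  · refine (Set.finite_singleton (Quot.mk _ ⟨X, hX⟩)).subset ?_
    rintro _ ⟨M, rfl, h⟩
    have := M.2.1
    exact Quot.sound (h.nonempty_linearEquiv hX)
  by_cases hnt : Nontrivial X.carrier
  · obtain ⟨X₁, X₂, i₁, p₁, i₂, p₂, hsum, h₁, h₂⟩ := X.exists_sum_of_not_indecomposable hX
    refine ((ih _ h₁ X₁ rfl).union (ih _ h₂ X₂ rfl)).subset ?_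
    rintro _ ⟨M, rfl, h⟩
    exact (h.of_sum M.2 i₁ p₁ i₂ p₂ hsum).imp
      (fun h => ⟨M, rfl, h⟩) (fun h => ⟨M, rfl, h⟩)
  · refine Set.finite_empty.subset ?_
    rintro _ ⟨M, rfl, i, p, hip⟩
    have := M.2.1
    obtain ⟨x, hx⟩ := exists_ne (0 : M.1.carrier)
    rw [not_nontrivial_iff_subsingleton] at hnt
    refine hx ?_
    rw [← LinearMap.id_apply (R := Aᵐᵒᵖ) x, ← hip, LinearMap.comp_apply,
      Subsingleton.elim (i x) 0, map_zero]

end FDRightModule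

open FDRightModule in
/-- If every finite-dimensional `B`-module is a retract of the restriction of a
finite-dimensional `A`-module, then finite representation type passes from `A` to `B`. -/
theorem HasFiniteRepresentationType.of_isModuleRetract_restrict {K A B : Type} [Field K] [Ring A]
    [Algebra K A] [Ring B] [Algebra K B] (φ : B →ₐ[K] A)
    (hφ : ∀ M : FDRightModule K B, ∃ X : FDRightModule K A,
      IsModuleRetract Bᵐᵒᵖ M.carrier (X.restrict φ).carrier)
    (hA : HasFiniteRepresentationType K A) : HasFiniteRepresentationType K B := by
  have : Finite (Quot (Indecomposable.Iso K A)) := hA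
  refine Set.finite_univ_iff.mp ((Set.finite_iUnion fun c : Quot (Indecomposable.Iso K A) =>
    finite_indecomposable_isModuleRetract (c.out.1.restrict φ)).subset ?_)
  rintro ⟨M⟩ -
  obtain ⟨X, hX⟩ := hφ M.1
  obtain ⟨Y, hY, h⟩ := exists_indecomposable_of_isModuleRetract φ M.1 M.2 X hX
  refine Set.mem_iUnion.mpr ⟨Quot.mk _ ⟨Y, hY⟩, M, rfl, h.trans ?_⟩
  have hequiv : Equivalence (Indecomposable.Iso K A) :=
    ⟨fun _ => ⟨.refl _ _⟩, fun ⟨e⟩ => ⟨e.symm⟩, fun ⟨e⟩ ⟨e'⟩ => ⟨e.trans e'⟩⟩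
  obtain ⟨e⟩ := (hequiv.quot_mk_eq_iff _ _).mp
    (Quot.out_eq (Quot.mk _ (⟨Y, hY⟩ : Indecomposable K A))).symm
  exact ⟨restrictMap φ e.toLinearMap, restrictMap φ e.symm.toLinearMap,
    LinearMap.ext fun x => e.symm_apply_apply x⟩

/-- A sequence whose first `n` terms satisfy the defining relations of the Iwahori--Hecke algebra
of type `Bₙ`. -/
structure IsHeckeBFamily {K E : Type*} [Field K] [Ring E] [Algebra K E] (α β q : K) (n : ℕ)
    (t : ℕ → E) : Prop where
  quad_zero : 0 < n → (t 0 - algebraMap K E α) * (t 0 - algebraMap K E β) = 0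
  quad : ∀ i, 0 < i → i < n → (t i + 1) * (t i - algebraMap K E q) = 0
  braid_zero : 1 < n → t 0 * t 1 * t 0 * t 1 = t 1 * t 0 * t 1 * t 0
  braid : ∀ i, 0 < i → i + 1 < n → t (i + 1) * t i * t (i + 1) = t i * t (i + 1) * t i
  comm : ∀ i j, i + 1 < j → j < n → t i * t j = t j * t i

namespace HeckeBInduced

variable {K M : Type*} [Field K] [AddCommGroup M] [Module K M]
  (α β q : K) (n : ℕ) (t : ℕ → Module.End K M)

/-- The action of `T_i` on the module induced from `Bₙ` to `Bₙ₊₁`. The cosets are indexed by the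
signed positions `(s, a)` with `a ≤ n`, the trivial coset being `(true, n)`. -/
def step (i : ℕ) (x : Bool → ℕ → M) (s : Bool) (a : ℕ) : M :=
  if n < a then 0
  else if i < a then t i (x s a)
  else if a + 1 < i then t (i - 1) (x s a)
  else if i = 0 then
    if s then -(α * β) • x false 0 else x true 0 + (α + β) • x false 0
  else if a = i then
    if s then q • x s (i - 1) else x s (i - 1) + (q - 1) • x s i
  else
    if s then x s i + (q - 1) • x s (i - 1) else q • x s i

section Eval

variable {n} (x : Bool → ℕ → M) (s : Bool) {i a : ℕ}

theorem step_of_lt (h : i < a) (ha : a ≤ n) : step α β q n t i x s a = t i (x s a) := by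
  simp [step, h, ha]

theorem step_of_gt (h : a < i) (ha : a ≤ n) : step α β q n t (i + 1) x s a = t i (x s a) := by
  rw [step, if_neg (by omega), if_neg (by omega), if_pos (by omega), Nat.add_sub_cancel]

theorem step_outside (ha : n < a) : step α β q n t i x s a = 0 := by
  simp [step, ha]

theorem step_zero_true : step α β q n t 0 x true 0 = -(α * β) • x false 0 := by
  simp [step]

theorem step_zero_false :
    step α β q n t 0 x false 0 = x true 0 + (α + β) • x false 0 := by
  simp [step]

theorem step_self_true (h : i + 1 ≤ n) :
    step α β q n t (i + 1) x true (i + 1) = q • x true i := by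
  simp [step, show ¬ n ≤ i by omega]

theorem step_self_false (h : i + 1 ≤ n) :
    step α β q n t (i + 1) x false (i + 1) = x false i + (q - 1) • x false (i + 1) := by
  simp [step, show ¬ n ≤ i by omega]

theorem step_pred_true (h : i ≤ n) :
    step α β q n t (i + 1) x true i = x true (i + 1) + (q - 1) • x true i := by
  simp [step, h]

theorem step_pred_false (h : i ≤ n) :
    step α β q n t (i + 1) x false i = q • x false (i + 1) := by
  simp [step, h]

end Eval

/-- The functions supported on the signed positions `(s, a)` with `a ≤ n`. -/
def space (K M : Type*) [Field K] [AddCommGroup M] [Module K M] (n : ℕ) :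
    Submodule K (Bool → ℕ → M) where
  carrier := {x | ∀ s a, n < a → x s a = 0}
  add_mem' hx hy s a h := by simp [hx s a h, hy s a h]
  zero_mem' _ _ _ := rfl
  smul_mem' c x hx s a h := by simp [hx s a h]

instance [FiniteDimensional K M] : FiniteDimensional K (space K M n) := by
  let r : space K M n →ₗ[K] (Bool → Fin (n + 1) → M) :=
    { toFun := fun x s a => x.1 s a
      map_add' := fun _ _ => rfl
      map_smul' := fun _ _ => rfl }
  refine FiniteDimensional.of_injective r fun x y h => Subtype.ext ?_
  funext s a
  by_cases ha : n < a
  · rw [x.2 s a ha, y.2 s a ha]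
  · exact congrFun (congrFun h s) ⟨a, by omega⟩

/-- The action of `T_i` on the induced module as a linear endomorphism. -/
def op (i : ℕ) : Module.End K (space K M n) where
  toFun x := ⟨step α β q n t i x.1, fun _ _ h => step_outside _ _ _ _ _ _ h⟩
  map_add' x y := by
    ext s a
    simp only [step, Submodule.coe_add, Pi.add_apply, map_add]
    split_ifs <;> module
  map_smul' c x := by
    ext s a
    simp only [step, SetLike.val_smul, Pi.smul_apply, map_smul, RingHom.id_apply]
    split_ifs <;> module

@[simp]
theorem coe_op (i : ℕ) (x : space K M n) :
    (op α β q n t i x : Bool → ℕ → M) = step α β q n t i x := rfl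

variable {α β q n t}

theorem quad_zero_apply (ht : IsHeckeBFamily α β q n t) (h : 0 < n) (m : M) :
    t 0 (t 0 m) = (α + β) • t 0 m - (α * β) • m := by
  have := LinearMap.congr_fun (ht.quad_zero h) m
  simp only [Module.End.mul_apply, LinearMap.sub_apply, Module.algebraMap_end_apply, map_sub,
    map_smul, LinearMap.zero_apply] at this
  rw [← sub_eq_zero, ← this]
  module

theorem quad_apply (ht : IsHeckeBFamily α β q n t) {i : ℕ} (hi : 0 < i) (h : i < n) (m : M) :
    t i (t i m) = (q - 1) • t i m + q • m := by
  have := LinearMap.congr_fun (ht.quad i hi h) m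
  simp only [Module.End.mul_apply, LinearMap.sub_apply, Module.algebraMap_end_apply, map_sub,
    map_smul, LinearMap.zero_apply, LinearMap.add_apply, Module.End.one_apply] at this
  rw [← sub_eq_zero, ← this]
  module

theorem step_quad_zero (ht : IsHeckeBFamily α β q n t) (x : Bool → ℕ → M) (s : Bool) {a : ℕ}
    (ha : a ≤ n) :
    step α β q n t 0 (step α β q n t 0 x) s a =
      (α + β) • step α β q n t 0 x s a - (α * β) • x s a := by
  rcases Nat.eq_zero_or_pos a with rfl | h
  · cases s <;> simp only [step_zero_true, step_zero_false] <;> module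
  · simp only [step_of_lt _ _ _ _ _ _ h ha]
    exact quad_zero_apply ht (by omega) _

theorem step_quad (ht : IsHeckeBFamily α β q n t) (x : Bool → ℕ → M) (s : Bool) {i a : ℕ}
    (hi : i + 1 ≤ n) (ha : a ≤ n) :
    step α β q n t (i + 1) (step α β q n t (i + 1) x) s a =
      (q - 1) • step α β q n t (i + 1) x s a + q • x s a := by
  obtain h | rfl | rfl | h : a < i ∨ a = i ∨ a = i + 1 ∨ i + 1 < a := by omega
  · simp only [step_of_gt _ _ _ _ _ _ h ha]
    exact quad_apply ht (by omega) (by omega) _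
  · cases s <;> simp only [step_self_true _ _ _ _ _ hi, step_self_false _ _ _ _ _ hi,
      step_pred_true _ _ _ _ _ ha, step_pred_false _ _ _ _ _ ha] <;> module
  · cases s <;> simp only [step_self_true _ _ _ _ _ hi, step_self_false _ _ _ _ _ hi,
      step_pred_true _ _ _ _ _ (Nat.le_of_succ_le hi),
      step_pred_false _ _ _ _ _ (Nat.le_of_succ_le hi)] <;> module
  · simp only [step_of_lt _ _ _ _ _ _ h ha]
    exact quad_apply ht (by omega) (by omega) _

theorem step_comm (ht : IsHeckeBFamily α β q n t) (x : Bool → ℕ → M) (s : Bool) {i j a : ℕ}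
    (hij : i + 1 < j + 1) (hj : j + 1 ≤ n) (ha : a ≤ n) :
    step α β q n t i (step α β q n t (j + 1) x) s a =
      step α β q n t (j + 1) (step α β q n t i x) s a := by
  have hcomm : ∀ i j, i + 1 < j → j < n → ∀ m, t i (t j m) = t j (t i m) :=
    fun i j h h' m => LinearMap.congr_fun (ht.comm i j h h') m
  obtain h | rfl | rfl | h : a < j ∨ a = j ∨ a = j + 1 ∨ j + 1 < a := by omega
  · obtain _ | i := i
    · obtain _ | a := a
      · cases s <;> simp (discharger := omega) only [step_of_gt, step_zero_true, step_zero_false,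
          map_add, map_smul]
      · simp (discharger := omega) only [step_of_gt, step_of_lt]
        exact hcomm _ _ (by omega) (by omega) _
    · obtain h' | rfl | rfl | h' : a < i ∨ a = i ∨ a = i + 1 ∨ i + 1 < a := by omega
      · simp (discharger := omega) only [step_of_gt]
        exact hcomm _ _ (by omega) (by omega) _
      · cases s <;> simp (discharger := omega) only [step_of_gt, step_pred_true, step_pred_false,
          map_add, map_smul]
      · cases s <;> simp (discharger := omega) only [step_of_gt, step_self_true,
          step_self_false, map_add, map_smul]
      · simp (discharger := omega) only [step_of_gt, step_of_lt]
        exact hcomm _ _ (by omega) (by omega) _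
  · cases s <;> simp (discharger := omega) only [step_of_lt, step_pred_true, step_pred_false,
      map_add, map_smul]
  · cases s <;> simp (discharger := omega) only [step_of_lt, step_self_true, step_self_false,
      map_add, map_smul]
  · simp (discharger := omega) only [step_of_lt]
    exact hcomm _ _ (by omega) (by omega) _

theorem step_braid (ht : IsHeckeBFamily α β q n t) (x : Bool → ℕ → M) (s : Bool) {i a : ℕ}
    (hi : i + 2 ≤ n) (ha : a ≤ n) :
    step α β q n t (i + 1 + 1) (step α β q n t (i + 1) (step α β q n t (i + 1 + 1) x)) s a =
      step α β q n t (i + 1) (step α β q n t (i + 1 + 1) (step α β q n t (i + 1) x)) s a := by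
  have hbraid : ∀ i, 0 < i → i + 1 < n → ∀ m, t (i + 1) (t i (t (i + 1) m)) =
      t i (t (i + 1) (t i m)) :=
    fun i h h' m => LinearMap.congr_fun (ht.braid i h h') m
  have hquad := quad_apply ht (i := i + 1) (by omega) (by omega)
  obtain h | rfl | rfl | rfl | h :
    a < i ∨ a = i ∨ a = i + 1 ∨ a = i + 1 + 1 ∨ i + 1 + 1 < a := by omega
  · simp (discharger := omega) only [step_of_gt]
    exact hbraid _ (by omega) (by omega) _
  iterate 3
    cases s <;> simp (discharger := omega) only [step_of_lt, step_of_gt, step_self_true,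
      step_self_false, step_pred_true, step_pred_false, map_add, map_smul, hquad] <;> module
  · simp (discharger := omega) only [step_of_lt]
    exact hbraid _ (by omega) (by omega) _

theorem step_braid_zero (ht : IsHeckeBFamily α β q n t) (x : Bool → ℕ → M) (s : Bool) {a : ℕ}
    (hn : 1 ≤ n) (ha : a ≤ n) :
    step α β q n t 0 (step α β q n t (0 + 1) (step α β q n t 0 (step α β q n t (0 + 1) x))) s a =
      step α β q n t (0 + 1) (step α β q n t 0 (step α β q n t (0 + 1) (step α β q n t 0 x)))
        s a := by
  have hquad := quad_zero_apply ht (by omega)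
  obtain rfl | rfl | h : a = 0 ∨ a = 0 + 1 ∨ 0 + 1 < a := by omega
  iterate 2
    cases s <;> simp (discharger := omega) only [step_of_lt, step_self_true, step_zero_true,
      step_zero_false, step_self_false, step_pred_true, step_pred_false, map_add, map_smul,
      hquad] <;> module
  · simp (discharger := omega) only [step_of_lt]
    exact LinearMap.congr_fun (ht.braid_zero (by omega)) _

theorem isHeckeBFamily_op (ht : IsHeckeBFamily α β q n t) :
    IsHeckeBFamily α β q (n + 1) (op α β q n t) := by
  have key : ∀ y z : space K M n, (∀ s a, a ≤ n → y.1 s a = z.1 s a) → y = z := by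
    intro y z h
    ext s a
    rcases le_or_gt a n with ha | ha
    · exact h s a ha
    · rw [y.2 s a ha, z.2 s a ha]
  refine ⟨fun _ => ?_, fun i hi hin => ?_, fun hn => ?_, fun i hi hin => ?_, fun i j hij hj => ?_⟩
  · refine LinearMap.ext fun x => key _ _ fun s a ha => ?_
    have := step_quad_zero ht x.1 s ha
    simp only [Module.End.mul_apply, LinearMap.sub_apply, Module.algebraMap_end_apply, map_sub,
      map_smul, LinearMap.zero_apply, Submodule.coe_sub, coe_op, Submodule.coe_smul,
      Pi.sub_apply, Pi.smul_apply, this, Submodule.coe_zero, Pi.zero_apply]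
    module
  · obtain ⟨i, rfl⟩ := Nat.exists_eq_add_of_le' hi
    refine LinearMap.ext fun x => key _ _ fun s a ha => ?_
    have := step_quad ht x.1 s (i := i) (by omega) ha
    simp only [Module.End.mul_apply, LinearMap.sub_apply, Module.algebraMap_end_apply, map_sub,
      map_smul, LinearMap.zero_apply, LinearMap.add_apply, Module.End.one_apply,
      Submodule.coe_sub, Submodule.coe_add, coe_op, Submodule.coe_smul, Pi.add_apply,
      Pi.sub_apply, Pi.smul_apply, this, Submodule.coe_zero, Pi.zero_apply]
    module
  · exact LinearMap.ext fun x => key _ _ fun s a ha => step_braid_zero ht x.1 s (by omega) ha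
  · obtain ⟨i, rfl⟩ := Nat.exists_eq_add_of_le' hi
    exact LinearMap.ext fun x => key _ _ fun s a ha => step_braid ht x.1 s (by omega) ha
  · obtain _ | j := j
    · omega
    exact LinearMap.ext fun x => key _ _ fun s a ha => step_comm ht x.1 s hij (by omega) ha

variable (K M n) in
/-- The inclusion of a module as the trivial coset of the induced module. -/
def incl : M →ₗ[K] space K M n where
  toFun m := ⟨fun s a => if s = true ∧ a = n then m else 0, fun s a h => if_neg (by omega)⟩
  map_add' x y := by
    ext s a
    simp only [Submodule.coe_add, Pi.add_apply]
    split_ifs <;> simp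
  map_smul' c x := by
    ext s a
    simp only [SetLike.val_smul, Pi.smul_apply, RingHom.id_apply]
    split_ifs <;> simp

variable (K M n) in
/-- The projection of the induced module onto the trivial coset. -/
def proj : space K M n →ₗ[K] M where
  toFun x := x.1 true n
  map_add' _ _ := rfl
  map_smul' _ _ := rfl

theorem proj_incl (m : M) : proj K M n (incl K M n m) = m := by
  simp [proj, incl]

theorem proj_op {i : ℕ} (hi : i < n) (x : space K M n) :
    proj K M n (op α β q n t i x) = t i (proj K M n x) :=
  step_of_lt α β q t x.1 true hi le_rfl

theorem op_incl {i : ℕ} (hi : i < n) (m : M) :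
    op α β q n t i (incl K M n m) = incl K M n (t i m) := by
  ext s a
  simp only [coe_op, incl, LinearMap.coe_mk, AddHom.coe_mk, step]
  split_ifs <;> simp_all <;> omega

end HeckeBInduced

namespace IsHeckeBFamily

variable {K E E' : Type*} [Field K] [Ring E] [Algebra K E] [Ring E'] [Algebra K E']
  {α β q : K} {n : ℕ} {t : ℕ → E}

theorem mono (ht : IsHeckeBFamily α β q n t) {m : ℕ} (h : m ≤ n) :
    IsHeckeBFamily α β q m t where
  quad_zero h' := ht.quad_zero (h'.trans_le h)
  quad i hi h' := ht.quad i hi (h'.trans_le h)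
  braid_zero h' := ht.braid_zero (h'.trans_le h)
  braid i hi h' := ht.braid i hi (h'.trans_le h)
  comm i j hij h' := ht.comm i j hij (h'.trans_le h)

theorem map (ht : IsHeckeBFamily α β q n t) (φ : E →ₐ[K] E') :
    IsHeckeBFamily α β q n (fun i => φ (t i)) where
  quad_zero h := by simpa using congrArg φ (ht.quad_zero h)
  quad i hi h := by simpa using congrArg φ (ht.quad i hi h)
  braid_zero h := by simpa using congrArg φ (ht.braid_zero h)
  braid i hi h := by simpa using congrArg φ (ht.braid i hi h)
  comm i j hij h := by simpa using congrArg φ (ht.comm i j hij h)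

theorem op (ht : IsHeckeBFamily α β q n t) :
    IsHeckeBFamily α β q n (fun i => MulOpposite.op (t i)) where
  quad_zero h := by
    have h₁ : Commute (t 0 - algebraMap K E α) (t 0 - algebraMap K E β) :=
      ((Commute.refl _).sub_left (Algebra.commute_algebraMap_left α _)).sub_right
        (Algebra.commute_algebraMap_right β _)
    exact congrArg MulOpposite.op (h₁.eq.symm.trans (ht.quad_zero h))
  quad i hi h := by
    have h₁ : Commute (t i + 1) (t i - algebraMap K E q) :=
      ((Commute.refl _).add_left (Commute.one_left _)).sub_right
        (Algebra.commute_algebraMap_right q _)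
    exact congrArg MulOpposite.op (h₁.eq.symm.trans (ht.quad i hi h))
  braid_zero h := by
    simpa [mul_assoc] using congrArg MulOpposite.op (ht.braid_zero h).symm
  braid i hi h := by
    simpa [mul_assoc] using congrArg MulOpposite.op (ht.braid i hi h)
  comm i j hij h := by
    simpa using congrArg MulOpposite.op (ht.comm i j hij h).symm

end IsHeckeBFamily

namespace HeckeB

variable {K : Type} [Field K] {α β q : K} {n : ℕ}

variable (α β q n) in
/-- The generator `T_i` of the Iwahori--Hecke algebra, taken to be zero for `i ≥ n`. -/
noncomputable def gen (i : ℕ) : HeckeB K α β q n :=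
  if h : i < n then RingQuot.mkAlgHom K (HeckeBRel K α β q n) (FreeAlgebra.ι K ⟨i, h⟩) else 0

theorem gen_of_lt {i : ℕ} (h : i < n) :
    gen α β q n i = RingQuot.mkAlgHom K (HeckeBRel K α β q n) (FreeAlgebra.ι K ⟨i, h⟩) :=
  dif_pos h

theorem isHeckeBFamily_gen : IsHeckeBFamily α β q n (gen α β q n) where
  quad_zero h := by
    simpa [gen_of_lt h] using
      RingQuot.mkAlgHom_rel K (HeckeBRel.quad_zero (α := α) (β := β) (q := q) ⟨0, h⟩ rfl)
  quad i hi h := by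
    simpa [gen_of_lt h] using
      RingQuot.mkAlgHom_rel K (HeckeBRel.quad (α := α) (β := β) (q := q) ⟨i, h⟩ hi)
  braid_zero h := by
    simpa [gen_of_lt h, gen_of_lt (Nat.zero_lt_of_lt h)] using
      RingQuot.mkAlgHom_rel K (HeckeBRel.braid_zero (α := α) (β := β) (q := q)
        ⟨0, Nat.zero_lt_of_lt h⟩ ⟨1, h⟩ rfl rfl)
  braid i hi h := by
    simpa [gen_of_lt h, gen_of_lt (Nat.lt_of_succ_lt h)] using
      RingQuot.mkAlgHom_rel K (HeckeBRel.braid (α := α) (β := β) (q := q)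
        ⟨i, Nat.lt_of_succ_lt h⟩ ⟨i + 1, h⟩ hi rfl)
  comm i j hij h := by
    have hi : i < n := by omega
    simpa [gen_of_lt h, gen_of_lt hi] using
      RingQuot.mkAlgHom_rel K (HeckeBRel.comm (α := α) (β := β) (q := q) ⟨i, hi⟩ ⟨j, h⟩ hij)

/-- The algebra homomorphism determined by the images of the generators. -/
noncomputable def lift {E : Type*} [Ring E] [Algebra K E] {t : ℕ → E}
    (ht : IsHeckeBFamily α β q n t) : HeckeB K α β q n →ₐ[K] E :=
  RingQuot.liftAlgHom K ⟨FreeAlgebra.lift K fun i : Fin n => t i, by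
    rintro _ _ (⟨⟨i, hin⟩, hi⟩ | ⟨i, hi⟩ | ⟨⟨i, hin⟩, ⟨j, hjn⟩, hi, hj⟩ |
      ⟨⟨i, hin⟩, ⟨j, hjn⟩, hi, hj⟩ | ⟨i, j, hij⟩)
    · obtain rfl : i = 0 := hi
      simpa using ht.quad_zero hin
    · simpa using ht.quad i hi i.2
    · obtain rfl : i = 0 := hi
      obtain rfl : j = 1 := hj
      simpa using ht.braid_zero hjn
    · obtain rfl : j = i + 1 := hj
      simpa using ht.braid i hi hjn
    · simpa using ht.comm i j hij j.2⟩

theorem lift_gen {E : Type*} [Ring E] [Algebra K E] {t : ℕ → E}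
    (ht : IsHeckeBFamily α β q n t) {i : ℕ} (h : i < n) : lift ht (gen α β q n i) = t i := by
  rw [gen_of_lt h, lift, RingQuot.liftAlgHom_mkAlgHom_apply, FreeAlgebra.lift_ι_apply]

variable (K α β q n) in
/-- The homomorphism from the algebra of type `Bₙ` to that of type `Bₙ₊₁` sending generators to
generators. -/
noncomputable def succHom : HeckeB K α β q n →ₐ[K] HeckeB K α β q (n + 1) :=
  lift (isHeckeBFamily_gen.mono n.le_succ)

/-- A linear map of right modules commuting with the generators is a module homomorphism. -/
def linearMapOfGen {M N : FDRightModule K (HeckeB K α β q n)} (g : M.carrier →ₗ[K] N.carrier)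
    (hg : ∀ i < n, ∀ m, g (MulOpposite.op (gen α β q n i) • m) =
      MulOpposite.op (gen α β q n i) • g m) :
    M.carrier →ₗ[(HeckeB K α β q n)ᵐᵒᵖ] N.carrier where
  toFun := g
  map_add' := map_add g
  map_smul' b m := by
    obtain ⟨b, rfl⟩ := MulOpposite.op_surjective b
    obtain ⟨b, rfl⟩ := RingQuot.mkAlgHom_surjective K _ b
    rw [RingHom.id_apply]
    induction b using FreeAlgebra.induction generalizing m with
    | grade0 r =>
      rw [AlgHom.commutes, ← MulOpposite.algebraMap_apply, algebraMap_smul, algebraMap_smul,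
        map_smul]
    | grade1 i => simpa only [gen_of_lt i.2] using hg i i.2 m
    | mul a b iha ihb => simp only [map_mul, MulOpposite.op_mul, mul_smul, iha, ihb]
    | add a b iha ihb => simp only [map_add, MulOpposite.op_add, add_smul, iha, ihb]

section Induced

variable (M : FDRightModule K (HeckeB K α β q n))

/-- The action of the generators on a right module. -/
noncomputable def genAction (i : ℕ) : Module.End K M.carrier :=
  Algebra.lsmul K K M.carrier (MulOpposite.op (gen α β q n i))

theorem isHeckeBFamily_genAction : IsHeckeBFamily α β q n (genAction M) :=
  isHeckeBFamily_gen.op.map (Algebra.lsmul K K M.carrier)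

/-- The action of the algebra of type `Bₙ₊₁` on the induced module. -/
noncomputable def inducedAction : (HeckeB K α β q (n + 1))ᵐᵒᵖ →ₐ[K]
    Module.End K (HeckeBInduced.space K M.carrier n) :=
  AlgHom.opComm (lift (HeckeBInduced.isHeckeBFamily_op (isHeckeBFamily_genAction M)).op)

/-- The right module induced from type `Bₙ` to type `Bₙ₊₁`. -/
noncomputable def induced : FDRightModule K (HeckeB K α β q (n + 1)) where
  carrier := HeckeBInduced.space K M.carrier n
  isAddCommGroup := inferInstance
  isModuleK := inferInstance
  isModuleA := Module.compHom _ (inducedAction M).toRingHom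
  isTower := by
    let _ : Module (HeckeB K α β q (n + 1))ᵐᵒᵖ (HeckeBInduced.space K M.carrier n) :=
      Module.compHom _ (inducedAction M).toRingHom
    refine ⟨fun c b x => ?_⟩
    change inducedAction M (c • b) x = c • inducedAction M b x
    rw [map_smul, LinearMap.smul_apply]
  isFinDim := inferInstance

theorem gen_smul_induced {i : ℕ} (h : i < n)
    (x : ((induced M).restrict (succHom K α β q n)).carrier) :
    MulOpposite.op (gen α β q n i) • x =
      HeckeBInduced.op α β q n (genAction M) i x := by
  change inducedAction M (MulOpposite.op (succHom K α β q n (gen α β q n i))) x = _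
  rw [succHom, lift_gen _ h, inducedAction, AlgHom.opComm_apply_apply, MulOpposite.unop_op,
    lift_gen _ (Nat.lt_succ_of_lt h), MulOpposite.unop_op]

theorem isModuleRetract_induced :
    IsModuleRetract (HeckeB K α β q n)ᵐᵒᵖ M.carrier
      ((induced M).restrict (succHom K α β q n)).carrier := by
  refine ⟨linearMapOfGen (HeckeBInduced.incl K M.carrier n) fun i hi m => ?_,
    linearMapOfGen (M := (induced M).restrict (succHom K α β q n)) (N := M)
      (HeckeBInduced.proj K M.carrier n) fun i hi x => ?_, ?_⟩
  · exact (HeckeBInduced.op_incl hi m).symm.trans (gen_smul_induced M hi _).symm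
  · exact (congrArg _ (gen_smul_induced M hi x)).trans (HeckeBInduced.proj_op hi x)
  · exact LinearMap.ext fun m => HeckeBInduced.proj_incl (K := K) (n := n) m

end Induced

end HeckeB

theorem heckeB_infinite_representation_type_monotone
    (K : Type) [Field K] (q : K) (hq : q ≠ 0)
    (f : ℕ) (hf : ((2 * f : ℕ) : ℕ∞) ≤ multOrder q) (m n : ℕ) (hm : 1 ≤ m) (hmn : m ≤ n)
    (h : ¬ HasFiniteRepresentationType K (HeckeB K 1 (q ^ f) q m)) :
    ¬ HasFiniteRepresentationType K (HeckeB K 1 (q ^ f) q n) := by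
  induction n, hmn using Nat.le_induction with
  | base => exact h
  | succ n _ ih =>
    exact fun h' => ih (h'.of_isModuleRetract_restrict (HeckeB.succHom K 1 (q ^ f) q n)
      fun M => ⟨HeckeB.induced M, HeckeB.isModuleRetract_induced M⟩)
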